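/- Let C be a finite set of candidates, PW = {pw_1,…,pw_l} ⊆ C a nonempty set of possible winners, and P a preference order on C with P(pw_a,pw_b) if and only if a < b. If a preference order P' on C locally dominates P (given PW), then the order of the possible winners is the same under P' as under P, i.e. P'(pw_a,pw_{a+1}) holds for all a ∈ {1,…,l−1}. -/

import Mathlib

/-- A preference order: a strict total order on candidates. -/
def IsPref {C : Type*} (P : C → C → Prop) : Prop :=
  (∀ a b : C, a ≠ b → P a b ∨ P b a) ∧ (∀ a : C, ¬ P a a) ∧
    ∀ a b c : C, P a b → P b c → P a c

/-- The Borda score that preference order `P` gives candidate `c`. -/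
noncomputable def borda {C : Type*} [Fintype C] (P : C → C → Prop) (c : C) : ℕ :=
  1 + Set.ncard {c' : C | P c c'}

/-- `c` is the outcome `F(s, P)`: it beats every other candidate either in total score
`s + borda`, or on equal total score by the tie-breaking order `tb`. -/
def IsWinner {C : Type*} [Fintype C] (tb : C → C → Prop) (s : C → ℕ)
    (P : C → C → Prop) (c : C) : Prop :=
  ∀ c' : C, c' ≠ c →
    s c' + borda P c' < s c + borda P c ∨
      (s c' + borda P c' = s c + borda P c ∧ tb c c')

/-- `s` is a possible world for the set `PW` of possible winners. -/
def PossibleWorld {C : Type*} [Fintype C] (tb : C → C → Prop) (PW : Set C)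
    (s : C → ℕ) : Prop :=
  ∀ R : C → C → Prop, IsPref R → ∀ c : C, IsWinner tb s R c → c ∈ PW

/-- `P'` locally dominates `P` given the possible-winner set `PW`. -/
def LocDom {C : Type*} [Fintype C] (tb : C → C → Prop) (PW : Set C)
    (P' P : C → C → Prop) : Prop :=
  (∀ s : C → ℕ, PossibleWorld tb PW s →
      ∀ w' w : C, IsWinner tb s P' w' → IsWinner tb s P w → w' = w ∨ P w' w) ∧
  ∃ s : C → ℕ, PossibleWorld tb PW s ∧
      ∃ w' w : C, IsWinner tb s P' w' ∧ IsWinner tb s P w ∧ P w' w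

/-- The (closed) segment `[c, P, c']` of candidates between `c` and `c'`. -/
def seg {C : Type*} (P : C → C → Prop) (c c' : C) : Set C :=
  {d : C | (d = c ∨ P c d) ∧ (d = c' ∨ P d c')}

theorem borda_le {C : Type*} [Fintype C] (P : C → C → Prop) (c : C) :
    borda P c ≤ 1 + Fintype.card C := by
  have h := Set.ncard_le_card {c' : C | P c c'}
  rw [Nat.card_eq_fintype_card] at h
  exact Nat.add_le_add_left h 1

theorem one_le_borda {C : Type*} [Fintype C] (P : C → C → Prop) (c : C) :
    1 ≤ borda P c :=
  Nat.le_add_right _ _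

theorem IsPref.borda_lt {C : Type*} [Fintype C] {P : C → C → Prop} (hP : IsPref P)
    {b c : C} (h : P c b) : borda P b < borda P c := by
  refine Nat.add_lt_add_left (Set.ncard_lt_ncard ⟨fun x hx => hP.2.2 _ _ _ h hx, fun hs => ?_⟩
    (Set.toFinite _)) 1
  exact hP.2.1 b (hs h)

open Classical in
/-- The score vector in which `b` and `c` are tied, out of reach of all other candidates. -/
noncomputable def pairScore {C : Type*} [Fintype C] (b c : C) (d : C) : ℕ :=
  if d = b ∨ d = c then Fintype.card C + 1 else 0

theorem pairScore_add_borda_lt {C : Type*} [Fintype C] {b c d e : C}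
    (hd : ¬ (d = b ∨ d = c)) (he : e = b ∨ e = c) (R : C → C → Prop) :
    pairScore b c d + borda R d < pairScore b c e + borda R e := by
  have h₁ := borda_le R d
  have h₂ := one_le_borda R e
  rw [pairScore, pairScore, if_neg hd, if_pos he]
  omega

theorem possibleWorld_pairScore {C : Type*} [Fintype C] (tb : C → C → Prop) {PW : Set C}
    {b c : C} (hb : b ∈ PW) (hc : c ∈ PW) : PossibleWorld tb PW (pairScore b c) := by
  intro R _ d hd
  by_cases h : d = b ∨ d = c
  · rcases h with rfl | rfl <;> assumption
  · have hlt := pairScore_add_borda_lt h (Or.inl rfl) R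
    rcases hd b (fun hbd => h (Or.inl hbd.symm)) with h' | h' <;> omega

theorem IsPref.isWinner_pairScore {C : Type*} [Fintype C] (tb : C → C → Prop)
    {R : C → C → Prop} (hR : IsPref R) {b c e f : C} (he : e = b ∨ e = c)
    (hf : ∀ d, d = b ∨ d = c → d ≠ e → d = f) (h : R e f) :
    IsWinner tb (pairScore b c) R e := by
  intro d hde
  left
  by_cases hd : d = b ∨ d = c
  · rw [pairScore, pairScore, if_pos hd, if_pos he, hf d hd hde]
    exact Nat.add_lt_add_left (hR.borda_lt h) _
  · exact pairScore_add_borda_lt hd he R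

/-- A locally dominating preference order ranks any two possible winners as the original
preference order does. -/
theorem LocDom.pref_of_pref {C : Type*} [Fintype C] {tb : C → C → Prop} {PW : Set C}
    {P P' : C → C → Prop} (hP : IsPref P) (hP' : IsPref P') (hdom : LocDom tb PW P' P)
    {b c : C} (hb : b ∈ PW) (hc : c ∈ PW) (h : P c b) : P' c b := by
  have hne : c ≠ b := by
    rintro rfl
    exact hP.2.1 _ h
  refine (hP'.1 c b hne).resolve_right fun h' => ?_
  have hw' : IsWinner tb (pairScore b c) P' b :=
    hP'.isWinner_pairScore tb (Or.inl rfl) (fun d hd hdb => hd.resolve_left hdb) h'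
  have hw : IsWinner tb (pairScore b c) P c :=
    hP.isWinner_pairScore tb (Or.inr rfl) (fun d hd hdc => hd.resolve_right hdc) h
  rcases hdom.1 _ (possibleWorld_pairScore tb hb hc) b c hw' hw with hbc | hbc
  · exact hne hbc.symm
  · exact hP.2.1 _ (hP.2.2 _ _ _ h hbc)

theorem statement1 {C : Type*} [Fintype C]
    (tb : C → C → Prop) (htb : IsPref tb)
    (l : ℕ) (hl : 0 < l) (pw : Fin l → C) (hinj : Function.Injective pw)
    (P P' : C → C → Prop) (hP : IsPref P) (hP' : IsPref P')
    (horder : ∀ a b : Fin l, P (pw a) (pw b) ↔ a < b)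
    (hdom : LocDom tb (Set.range pw) P' P) :
    ∀ a : ℕ, ∀ h : a + 1 < l, P' (pw ⟨a, by omega⟩) (pw ⟨a + 1, h⟩) := by
  intro a h
  exact hdom.pref_of_pref hP hP' ⟨_, rfl⟩ ⟨_, rfl⟩ ((horder _ _).2 (Fin.mk_lt_mk.2 a.lt_succ_self))
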